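/- For every half-integer m ∈ {0.5, 1.0, 1.5, ..., 15.0}, ΓCDF_m(0.98·m) ≥ 0.5/0.999, where ΓCDF_m is the CDF of the Gamma distribution Γ(m, 1). -/

import Mathlib

open MeasureTheory ProbabilityTheory

/-- The lower incomplete gamma function `γ(a, x) = ∫₀ˣ t ^ (a - 1) e⁻ᵗ dt`. -/
noncomputable def lowerGamma (a x : ℝ) : ℝ :=
  ∫ t in (0 : ℝ)..x, Real.exp (-t) * t ^ (a - 1)

lemma intervalIntegrable_exp_neg_mul_rpow {a x : ℝ} (ha : 0 < a) (hx : 0 ≤ x) :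
    IntervalIntegrable (fun t : ℝ ↦ Real.exp (-t) * t ^ (a - 1)) volume 0 x :=
  (intervalIntegrable_iff_integrableOn_Ioc_of_le hx).2
    ((Real.GammaIntegral_convergent ha).mono_set Set.Ioc_subset_Ioi_self)

lemma lowerGamma_nonneg {a x : ℝ} (hx : 0 ≤ x) : 0 ≤ lowerGamma a x :=
  intervalIntegral.integral_nonneg hx fun _ ht ↦
    mul_nonneg (Real.exp_pos _).le (Real.rpow_nonneg ht.1 _)

lemma lowerGamma_add_one {a x : ℝ} (ha : 0 < a) (hx : 0 ≤ x) :
    lowerGamma (a + 1) x = a * lowerGamma a x - Real.exp (-x) * x ^ a := by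
  have hint := intervalIntegrable_exp_neg_mul_rpow ha hx
  have hint' := intervalIntegrable_exp_neg_mul_rpow (a := a + 1) (by linarith) hx
  have key := intervalIntegral.integral_eq_sub_of_hasDerivAt_of_le hx
    (f := fun t : ℝ ↦ Real.exp (-t) * t ^ a)
    (f' := fun t : ℝ ↦ a * (Real.exp (-t) * t ^ (a - 1)) - Real.exp (-t) * t ^ (a + 1 - 1))
    (ContinuousOn.mul (by fun_prop)
      (continuousOn_id.rpow_const fun _ _ ↦ Or.inr ha.le))
    (fun t ht ↦ ((hasDerivAt_neg t).exp.mul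
      (Real.hasDerivAt_rpow_const (p := a) (Or.inl ht.1.ne'))).congr_deriv
        (by rw [add_sub_cancel_right]; ring))
    ((hint.const_mul a).sub hint')
  rw [intervalIntegral.integral_sub (hint.const_mul a) hint',
    intervalIntegral.integral_const_mul, Real.zero_rpow ha.ne'] at key
  unfold lowerGamma
  linarith

/-- The CDF of `Γ(a, 1)` is the regularized lower incomplete gamma function. -/
lemma cdf_gammaMeasure_one {a x : ℝ} (ha : 0 < a) (hx : 0 ≤ x) :
    cdf (gammaMeasure a 1) x = lowerGamma a x / Real.Gamma a := by
  rw [cdf_gammaMeasure_eq_integral ha one_pos,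
    setIntegral_eq_of_subset_of_forall_sdiff_eq_zero measurableSet_Iic
      (Set.Icc_subset_Iic_self (a := 0)), integral_Icc_eq_integral_Ioc, lowerGamma,
    intervalIntegral.integral_of_le hx, ← integral_div]
  · refine setIntegral_congr_fun measurableSet_Ioc fun t ht ↦ ?_
    simp only [gammaPDFReal, if_pos ht.1.le, Real.one_rpow, one_mul]
    ring
  · intro t ht
    exact if_neg fun h ↦ ht.2 ⟨h, ht.1⟩

/-- The first `N` terms of `∑ₖ xᵏ / ((a + 1) ⋯ (a + k))`, in nested form. -/
def kummerSum {K : Type*} [Field K] (x : K) : ℕ → K → K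
  | 0, _ => 0
  | N + 1, a => 1 + x / (a + 1) * kummerSum x N (a + 1)

lemma ratCast_kummerSum (x : ℚ) (N : ℕ) (a : ℚ) :
    ((kummerSum x N a : ℚ) : ℝ) = kummerSum (x : ℝ) N (a : ℝ) := by
  induction N generalizing a with
  | zero => simp [kummerSum]
  | succ N ih => simp [kummerSum, ih]

lemma kummerSum_le_lowerGamma {x : ℝ} (hx : 0 < x) (N : ℕ) {a : ℝ} (ha : 0 < a) :
    Real.exp (-x) * x ^ a / Real.Gamma (a + 1) * kummerSum x N a ≤
      lowerGamma a x / Real.Gamma a := by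
  induction N generalizing a with
  | zero =>
    rw [kummerSum, mul_zero]
    exact div_nonneg (lowerGamma_nonneg hx.le) (Real.Gamma_pos_of_pos ha).le
  | succ N ih =>
    have h := ih (a := a + 1) (by linarith)
    have ha' : a + 1 ≠ 0 := by positivity
    have hΓ := (Real.Gamma_pos_of_pos ha).ne'
    rw [lowerGamma_add_one ha hx.le, Real.Gamma_add_one ha', Real.Gamma_add_one ha.ne',
      Real.rpow_add_one hx.ne'] at h
    rw [kummerSum, Real.Gamma_add_one ha.ne']
    calc _ = Real.exp (-x) * x ^ a / (a * Real.Gamma a) +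
          Real.exp (-x) * (x ^ a * x) / ((a + 1) * (a * Real.Gamma a)) *
            kummerSum x N (a + 1) := by field_simp
      _ ≤ Real.exp (-x) * x ^ a / (a * Real.Gamma a) +
          (a * lowerGamma a x - Real.exp (-x) * x ^ a) / (a * Real.Gamma a) := by gcongr
      _ = _ := by field_simp; ring

/-- A rational upper bound for `Γ(n / 2 + 1) ^ 2`. -/
def gammaHalfSqBound : ℕ → ℚ
  | 0 => 1
  | 1 => 3.1416 / 4
  | n + 2 => (n / 2 + 1) ^ 2 * gammaHalfSqBound n

lemma Gamma_half_sq_le (n : ℕ) :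
    Real.Gamma ((n : ℝ) / 2 + 1) ^ 2 ≤ (gammaHalfSqBound n : ℝ) := by
  induction n using Nat.twoStepInduction with
  | zero => simp [gammaHalfSqBound]
  | one =>
    rw [Nat.cast_one, Real.Gamma_add_one (by norm_num), Real.Gamma_one_half_eq, mul_pow,
      Real.sq_sqrt Real.pi_pos.le]
    have := Real.pi_lt_d4
    norm_num [gammaHalfSqBound]
    linarith
  | more n ih _ =>
    have h : ((n + 2 : ℕ) : ℝ) / 2 = n / 2 + 1 := by push_cast; ring
    rw [h, Real.Gamma_add_one (by positivity), mul_pow, gammaHalfSqBound]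
    push_cast
    gcongr

lemma exp_049_lt : Real.exp 0.49 < 1.63232 := by
  refine lt_of_pow_lt_pow_left₀ 100 (by norm_num) ?_
  calc Real.exp 0.49 ^ 100 = Real.exp 1 ^ 49 := by
        rw [← Real.exp_nat_mul, ← Real.exp_nat_mul]; norm_num
    _ < 2.7182818286 ^ 49 := by gcongr; exact Real.exp_one_lt_d9
    _ < 1.63232 ^ 100 := by norm_num

lemma kummerSum_numeric_bound : ∀ n ∈ Finset.Icc (1 : ℕ) 30,
    0 ≤ kummerSum (0.49 * n : ℚ) 40 (n / 2) ∧
    (500 / 999 : ℚ) ^ 2 * (gammaHalfSqBound n * (1.63232 ^ n) ^ 2) ≤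
      (0.49 * n : ℚ) ^ n * kummerSum (0.49 * n : ℚ) 40 (n / 2) ^ 2 := by
  decide +kernel

/-- For every half-integer `m ∈ {0.5, 1.0, …, 15.0}`, the Gamma distribution
`Γ(m, 1)` satisfies `ΓCDF_m(0.98·m) ≥ 0.5/0.999`. -/
theorem gamma_cdf_below_mean (m : ℝ)
    (hm : ∃ n : ℕ, 1 ≤ n ∧ n ≤ 30 ∧ m = (n : ℝ) / 2) :
    ENNReal.ofReal ((0.5 : ℝ) / 0.999) ≤ gammaMeasure m 1 (Set.Iic (0.98 * m)) := by
  obtain ⟨n, h1, h30, rfl⟩ := hm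
  have hn : (0 : ℝ) < n := by exact_mod_cast h1
  have hm : (0 : ℝ) < n / 2 := by positivity
  have hx : (0 : ℝ) < 0.49 * n := by positivity
  have : IsProbabilityMeasure (gammaMeasure ((n : ℝ) / 2) 1) :=
    isProbabilityMeasure_gammaMeasure hm one_pos
  rw [show (0.98 : ℝ) * (n / 2) = 0.49 * n by ring, ← ofReal_cdf, cdf_gammaMeasure_one hm hx.le]
  refine ENNReal.ofReal_le_ofReal (le_trans ?_ (kummerSum_le_lowerGamma hx 40 hm))
  have hΓ : 0 < Real.Gamma ((n : ℝ) / 2 + 1) := Real.Gamma_pos_of_pos (by positivity)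
  obtain ⟨hS, hnum⟩ := kummerSum_numeric_bound n (Finset.mem_Icc.2 ⟨h1, h30⟩)
  have hcast : ((kummerSum (0.49 * n : ℚ) 40 (n / 2) : ℚ) : ℝ) =
      kummerSum (0.49 * n : ℝ) 40 ((n : ℝ) / 2) := by
    rw [ratCast_kummerSum]; push_cast; norm_num
  replace hS : 0 ≤ kummerSum (0.49 * n : ℝ) 40 ((n : ℝ) / 2) := by
    rw [← hcast]; exact_mod_cast hS
  replace hnum : (500 / 999 : ℝ) ^ 2 * (gammaHalfSqBound n * (1.63232 ^ n) ^ 2) ≤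
      (0.49 * n : ℝ) ^ n * kummerSum (0.49 * n : ℝ) 40 ((n : ℝ) / 2) ^ 2 := by
    rw [← hcast]
    have h := (Rat.cast_le (K := ℝ)).2 hnum
    push_cast [Rat.cast_ofScientific] at h
    exact h
  have hexp : Real.exp (0.49 * n) ≤ 1.63232 ^ n := by
    rw [mul_comm, Real.exp_nat_mul]
    gcongr
    exact exp_049_lt.le
  have hpow : ((0.49 * n : ℝ) ^ ((n : ℝ) / 2)) ^ 2 = (0.49 * n : ℝ) ^ n := by
    rw [← Real.rpow_mul_natCast hx.le, Nat.cast_ofNat, div_mul_cancel₀ _ two_ne_zero,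
      Real.rpow_natCast]
  have hsq : (500 / 999 * (Real.Gamma ((n : ℝ) / 2 + 1) * Real.exp (0.49 * n))) ^ 2 ≤
      ((0.49 * n : ℝ) ^ ((n : ℝ) / 2) * kummerSum (0.49 * n : ℝ) 40 ((n : ℝ) / 2)) ^ 2 := by
    rw [mul_pow, mul_pow, mul_pow, hpow]
    refine le_trans ?_ hnum
    have hG := Gamma_half_sq_le n
    have hG₀ := (sq_nonneg _).trans hG
    gcongr
  have hle := (sq_le_sq₀ (by positivity) (by positivity)).1 hsq
  calc (0.5 : ℝ) / 0.999 = 500 / 999 := by norm_num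
    _ ≤ (0.49 * n : ℝ) ^ ((n : ℝ) / 2) * kummerSum (0.49 * n : ℝ) 40 ((n : ℝ) / 2) /
        (Real.Gamma ((n : ℝ) / 2 + 1) * Real.exp (0.49 * n)) :=
      (le_div_iff₀ (by positivity)).2 hle
    _ = _ := by rw [Real.exp_neg]; field_simp
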